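/- Let Ω ⊂ ℝⁿ be a domain, λ > 0, and f ∈ bmo_λ(Ω). Suppose f vanishes at infinity, i.e., lim_{R→∞} ‖f‖_{bmo_λ(Ω ∖ closure(B(0,R)))} = 0, and that there exists β > 0 such that sup{ |f_Q| · ℓ(Q) : Q a cube ⊂ Ω with dist(Q,0) > β and ℓ(Q) < λ } < ∞. Then there exist functions f_k ∈ bmo_λ(Ω) whose supports are compact subsets of the closure of Ω (i.e., bounded) such that ‖f − f_k‖_{bmo_λ(Ω)} → 0. -/

import Mathlib

open MeasureTheory Metric Filter Topology

noncomputable section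

/-- A closed axis-parallel cube in ℝⁿ: a closed ball in the sup norm with
positive radius (`half` = half the sidelength). -/
structure Cube (n : ℕ) where
  center : Fin n → ℝ
  half : ℝ
  half_pos : 0 < half

namespace Cube

variable {n : ℕ}

/-- The underlying set of a cube. -/
def toSet (Q : Cube n) : Set (Fin n → ℝ) := Metric.closedBall Q.center Q.half

/-- The sidelength ℓ(Q). -/
def side (Q : Cube n) : ℝ := 2 * Q.half

/-- The mean f_Q of f over Q. -/
def avg (Q : Cube n) (f : (Fin n → ℝ) → ℝ) : ℝ := ⨍ x in Q.toSet, f x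

/-- Mean oscillation of f over Q. -/
def osc (Q : Cube n) (f : (Fin n → ℝ) → ℝ) : ℝ := ⨍ x in Q.toSet, |f x - Q.avg f|

/-- The mean |f|_Q of |f| over Q. -/
def avgAbs (Q : Cube n) (f : (Fin n → ℝ) → ℝ) : ℝ := ⨍ x in Q.toSet, |f x|

/-- Distance from the cube to the origin. -/
def distToOrigin (Q : Cube n) : ℝ := Metric.infDist (0 : Fin n → ℝ) Q.toSet

/-- The cube 2Q, concentric with Q and of twice the sidelength. -/
def double (Q : Cube n) : Cube n := ⟨Q.center, 2 * Q.half, mul_pos two_pos Q.half_pos⟩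

end Cube

variable {n : ℕ}

/-- The modulus of mean oscillation ω_U(f,t): the supremum of the mean oscillation
of f over cubes Q ⊆ U of sidelength < t. -/
def omegaOn (U : Set (Fin n → ℝ)) (f : (Fin n → ℝ) → ℝ) (t : ℝ) : ℝ :=
  sSup {r | ∃ Q : Cube n, Q.toSet ⊆ U ∧ Q.side < t ∧ r = Q.osc f}

/-- sup{ |f|_Q : Q ⊆ U, ℓ(Q) ≥ lam }. -/
def bigAvgSup (U : Set (Fin n → ℝ)) (lam : ℝ) (f : (Fin n → ℝ) → ℝ) : ℝ :=
  sSup {r | ∃ Q : Cube n, Q.toSet ⊆ U ∧ lam ≤ Q.side ∧ r = Q.avgAbs f}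

/-- The nonhomogeneous norm ‖f‖_{bmo_lam(U)}. -/
def bmoNorm (U : Set (Fin n → ℝ)) (lam : ℝ) (f : (Fin n → ℝ) → ℝ) : ℝ :=
  omegaOn U f lam + bigAvgSup U lam f

/-- Membership in bmo_lam(U): integrable on every cube in U and finite norm. -/
def MemBmo (U : Set (Fin n → ℝ)) (lam : ℝ) (f : (Fin n → ℝ) → ℝ) : Prop :=
  (∀ Q : Cube n, Q.toSet ⊆ U → IntegrableOn f Q.toSet) ∧
  BddAbove {r | ∃ Q : Cube n, Q.toSet ⊆ U ∧ Q.side < lam ∧ r = Q.osc f} ∧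
  BddAbove {r | ∃ Q : Cube n, Q.toSet ⊆ U ∧ lam ≤ Q.side ∧ r = Q.avgAbs f}

/-- Sarason's vanishing mean oscillation condition: ω_U(f,t) → 0 as t → 0⁺. -/
def VanishSmallOsc (U : Set (Fin n → ℝ)) (f : (Fin n → ℝ) → ℝ) : Prop :=
  Tendsto (fun t => omegaOn U f t) (nhdsWithin 0 (Set.Ioi 0)) (nhds 0)

/-- f is bounded on U. -/
def BoundedOn (U : Set (Fin n → ℝ)) (f : (Fin n → ℝ) → ℝ) : Prop :=
  ∃ M : ℝ, ∀ x ∈ U, |f x| ≤ M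

/-- f is Lipschitz on U. -/
def LipschitzOn (U : Set (Fin n → ℝ)) (f : (Fin n → ℝ) → ℝ) : Prop :=
  ∃ K : NNReal, LipschitzOnWith K f U

/-- dist(supp f, ∂U) > 0. -/
def SuppAway (U : Set (Fin n → ℝ)) (f : (Fin n → ℝ) → ℝ) : Prop :=
  ∃ d > 0, ∀ x ∈ Function.support f, ∀ y ∈ frontier U, d ≤ dist x y

/-- The nonhomogeneous Lipschitz norm ‖f‖_{Lip_b(U)} = ‖f‖_∞ + Lipschitz seminorm. -/
def lipbNorm (U : Set (Fin n → ℝ)) (f : (Fin n → ℝ) → ℝ) : ℝ :=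
  sSup {r | ∃ x ∈ U, r = |f x|} +
  sSup {r | ∃ x ∈ U, ∃ y ∈ U, x ≠ y ∧ r = |f x - f y| / dist x y}

/-- U is a domain: a nonempty open connected subset of ℝⁿ. -/
def IsRealDomain (U : Set (Fin n → ℝ)) : Prop := IsOpen U ∧ IsConnected U

/-- U is an (ε,δ)-domain. -/
def IsEpsDeltaDomain (U : Set (Fin n → ℝ)) (ε δ : ℝ) : Prop :=
  ∀ x ∈ U, ∀ y ∈ U, dist x y < δ →
    ∃ γ : ℝ → (Fin n → ℝ), ContinuousOn γ (Set.Icc 0 1) ∧ γ 0 = x ∧ γ 1 = y ∧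
      (∀ t ∈ Set.Icc (0:ℝ) 1, γ t ∈ U) ∧
      eVariationOn γ (Set.Icc 0 1) ≤ ENNReal.ofReal (ε⁻¹ * dist x y) ∧
      ∀ t ∈ Set.Icc (0:ℝ) 1,
        ε * (dist (γ t) x * dist (γ t) y) / dist x y ≤ Metric.infDist (γ t) (frontier U)

/-- The natural scale λ_{ε,δ} for an (ε,δ)-domain. -/
def lamED (n : ℕ) (ε δ : ℝ) : ℝ := ε ^ 2 * δ / (320 * n * (1 + Real.sqrt n * ε))

/-- d_Ω(x) = dist(x,∂Ω). -/
def distBd (U : Set (Fin n → ℝ)) (x : Fin n → ℝ) : ℝ := Metric.infDist x (frontier U)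

/-- Ω̊_t = {x ∈ Ω : d_Ω(x) ≥ t}. -/
def innerPart (U : Set (Fin n → ℝ)) (t : ℝ) : Set (Fin n → ℝ) :=
  {x ∈ U | t ≤ distBd U x}

/-- f vanishes at infinity in the bmo_lam(U) sense. -/
def VanishAtInfinity (U : Set (Fin n → ℝ)) (lam : ℝ) (f : (Fin n → ℝ) → ℝ) : Prop :=
  Tendsto (fun R => bmoNorm (U \ Metric.closedBall 0 R) lam f) atTop (nhds 0)

/-- f vanishes at the boundary in the bmo_lam(U) sense. -/
def VanishAtBoundary (U : Set (Fin n → ℝ)) (lam : ℝ) (f : (Fin n → ℝ) → ℝ) : Prop :=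
  Tendsto (fun t => bmoNorm (U \ innerPart U t) lam f) (nhdsWithin 0 (Set.Ioi 0)) (nhds 0)

/-- f is in the bmo_lam(U)-closure of the continuous functions with compact support in U. -/
def InCmoClosure (U : Set (Fin n → ℝ)) (lam : ℝ) (f : (Fin n → ℝ) → ℝ) : Prop :=
  ∃ g : ℕ → (Fin n → ℝ) → ℝ,
    (∀ j, Continuous (g j) ∧ HasCompactSupport (g j) ∧ tsupport (g j) ⊆ U) ∧
    Tendsto (fun j => bmoNorm U lam (f - g j)) atTop (nhds 0)

/-- The homogeneous BMO(ℝⁿ) seminorm: sup of mean oscillation over all cubes. -/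
def bmoHNorm (f : (Fin n → ℝ) → ℝ) : ℝ := sSup {r | ∃ Q : Cube n, r = Q.osc f}

namespace Cube

/-- The normalized Lebesgue measure on a cube, whose integrals are the means over the cube. -/
def law (Q : Cube n) : Measure (Fin n → ℝ) :=
  ((volume.restrict Q.toSet) Set.univ)⁻¹ • volume.restrict Q.toSet

theorem volume_toSet (Q : Cube n) : volume Q.toSet = ENNReal.ofReal ((2 * Q.half) ^ n) := by
  simpa [toSet] using Real.volume_pi_closedBall Q.center Q.half_pos.le

theorem volume_real_toSet (Q : Cube n) : volume.real Q.toSet = (2 * Q.half) ^ n := by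
  have := Q.half_pos
  rw [measureReal_def, volume_toSet, ENNReal.toReal_ofReal (by positivity)]

theorem volume_toSet_ne_zero (Q : Cube n) : volume Q.toSet ≠ 0 := by
  have := Q.half_pos
  rw [volume_toSet, ne_eq, ENNReal.ofReal_eq_zero, not_le]
  positivity

theorem volume_toSet_ne_top (Q : Cube n) : volume Q.toSet ≠ ⊤ := by
  rw [volume_toSet]
  exact ENNReal.ofReal_ne_top

theorem measurableSet_toSet (Q : Cube n) : MeasurableSet Q.toSet :=
  Metric.isClosed_closedBall.measurableSet

instance (Q : Cube n) : IsProbabilityMeasure Q.law := by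
  refine ⟨?_⟩
  simp only [law, Measure.smul_apply, smul_eq_mul, Measure.restrict_apply_univ]
  exact ENNReal.inv_mul_cancel Q.volume_toSet_ne_zero Q.volume_toSet_ne_top

theorem ae_mem_law (Q : Cube n) : ∀ᵐ x ∂Q.law, x ∈ Q.toSet :=
  Measure.ae_smul_measure (ae_restrict_mem Q.measurableSet_toSet) _

theorem integrable_law {Q : Cube n} {g : (Fin n → ℝ) → ℝ} (hg : IntegrableOn g Q.toSet) :
    Integrable g Q.law :=
  hg.smul_measure (by simpa [law] using Q.volume_toSet_ne_zero)

theorem avg_eq (Q : Cube n) (g : (Fin n → ℝ) → ℝ) : Q.avg g = ∫ x, g x ∂Q.law := rfl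

theorem osc_eq (Q : Cube n) (g : (Fin n → ℝ) → ℝ) :
    Q.osc g = ∫ x, |g x - Q.avg g| ∂Q.law := rfl

theorem avgAbs_eq (Q : Cube n) (g : (Fin n → ℝ) → ℝ) :
    Q.avgAbs g = ∫ x, |g x| ∂Q.law := rfl

theorem setIntegral_abs_eq (Q : Cube n) (g : (Fin n → ℝ) → ℝ) :
    ∫ x in Q.toSet, |g x| = (2 * Q.half) ^ n * Q.avgAbs g := by
  have := Q.half_pos
  rw [avgAbs, setAverage_eq, volume_real_toSet, smul_eq_mul, mul_inv_cancel_left₀ (by positivity)]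

theorem osc_nonneg (Q : Cube n) (g : (Fin n → ℝ) → ℝ) : 0 ≤ Q.osc g := by
  rw [osc_eq]
  exact integral_nonneg fun _ => abs_nonneg _

theorem avgAbs_nonneg (Q : Cube n) (g : (Fin n → ℝ) → ℝ) : 0 ≤ Q.avgAbs g := by
  rw [avgAbs_eq]
  exact integral_nonneg fun _ => abs_nonneg _

theorem avg_congr {Q : Cube n} {g h : (Fin n → ℝ) → ℝ} (H : Set.EqOn g h Q.toSet) :
    Q.avg g = Q.avg h := by
  rw [avg_eq, avg_eq]
  exact integral_congr_ae (Q.ae_mem_law.mono fun x hx => H hx)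

theorem osc_congr {Q : Cube n} {g h : (Fin n → ℝ) → ℝ} (H : Set.EqOn g h Q.toSet) :
    Q.osc g = Q.osc h := by
  rw [osc_eq, osc_eq, avg_congr H]
  exact integral_congr_ae (Q.ae_mem_law.mono fun x hx => by simp only [H hx])

theorem avgAbs_congr {Q : Cube n} {g h : (Fin n → ℝ) → ℝ} (H : Set.EqOn g h Q.toSet) :
    Q.avgAbs g = Q.avgAbs h := by
  rw [avgAbs_eq, avgAbs_eq]
  exact integral_congr_ae (Q.ae_mem_law.mono fun x hx => by simp only [H hx])

theorem avgAbs_mono {Q : Cube n} {g h : (Fin n → ℝ) → ℝ} (hh : IntegrableOn h Q.toSet)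
    (H : ∀ x ∈ Q.toSet, |g x| ≤ |h x|) : Q.avgAbs g ≤ Q.avgAbs h := by
  rw [avgAbs_eq, avgAbs_eq]
  exact integral_mono_of_nonneg (ae_of_all _ fun _ => abs_nonneg _)
    (integrable_law hh).abs (Q.ae_mem_law.mono H)

/-- The mean oscillation is at most twice the mean distance to any constant. -/
theorem osc_le_two_mul {Q : Cube n} {g : (Fin n → ℝ) → ℝ} (hg : IntegrableOn g Q.toSet)
    (c : ℝ) : Q.osc g ≤ 2 * ∫ x, |g x - c| ∂Q.law := by
  have hi : Integrable (fun x => g x - c) Q.law := (integrable_law hg).sub (integrable_const c)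
  have hc : |Q.avg g - c| ≤ ∫ x, |g x - c| ∂Q.law := by
    have : Q.avg g - c = ∫ x, (g x - c) ∂Q.law := by
      rw [integral_sub (integrable_law hg) (integrable_const c), avg_eq]
      simp
    rw [this]
    exact abs_integral_le_integral_abs
  have hm : Q.osc g ≤ ∫ x, (|g x - c| + |Q.avg g - c|) ∂Q.law := by
    rw [osc_eq]
    refine integral_mono ((integrable_law hg).sub (integrable_const _)).abs
      (hi.abs.add (integrable_const _)) fun x => ?_
    have := abs_sub (g x - c) (Q.avg g - c)
    simpa using this
  rw [integral_add hi.abs (integrable_const _)] at hm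
  simp at hm
  linarith

theorem osc_sub_le {Q : Cube n} {g h : (Fin n → ℝ) → ℝ} (hg : IntegrableOn g Q.toSet)
    (hh : IntegrableOn h Q.toSet) : Q.osc (g - h) ≤ Q.osc g + Q.osc h := by
  have hg' := integrable_law hg
  have hh' := integrable_law hh
  have ha : Q.avg (g - h) = Q.avg g - Q.avg h := by
    simp only [avg_eq]
    exact integral_sub hg' hh'
  have hig : Integrable (fun x => |g x - Q.avg g|) Q.law := (hg'.sub (integrable_const _)).abs
  have hih : Integrable (fun x => |h x - Q.avg h|) Q.law := (hh'.sub (integrable_const _)).abs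
  rw [osc_eq, osc_eq, osc_eq, ← integral_add hig hih, ha]
  refine integral_mono ((hg'.sub hh').sub (integrable_const _)).abs (hig.add hih) fun x => ?_
  have := abs_sub (g x - Q.avg g) (h x - Q.avg h)
  simpa [sub_sub_sub_comm] using this

/-- Multiplying by a Lipschitz function with values in `[0, 1]` at most doubles the oscillation,
up to an error controlled by the mean of the function times the sidelength. -/
theorem osc_mul_le {Q : Cube n} {g ψ : (Fin n → ℝ) → ℝ} {L : ℝ} (hg : IntegrableOn g Q.toSet)
    (hgψ : IntegrableOn (fun x => ψ x * g x) Q.toSet) (hL : 0 ≤ L)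
    (hψ : ∀ x, |ψ x| ≤ 1) (hLip : ∀ x y, |ψ x - ψ y| ≤ L * dist x y) :
    Q.osc (fun x => ψ x * g x) ≤ 2 * Q.osc g + L * (|Q.avg g| * Q.side) := by
  have hg' := integrable_law hg
  have hi : Integrable (fun x => |g x - Q.avg g|) Q.law := (hg'.sub (integrable_const _)).abs
  have key : ∫ x, |ψ x * g x - ψ Q.center * Q.avg g| ∂Q.law ≤
      ∫ x, (|g x - Q.avg g| + L * Q.half * |Q.avg g|) ∂Q.law := by
    refine integral_mono_of_nonneg (ae_of_all _ fun _ => abs_nonneg _)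
      (hi.add (integrable_const _)) (Q.ae_mem_law.mono fun x hx => ?_)
    have hd : dist x Q.center ≤ Q.half := hx
    calc |ψ x * g x - ψ Q.center * Q.avg g|
        = |ψ x * (g x - Q.avg g) + (ψ x - ψ Q.center) * Q.avg g| := by ring_nf
      _ ≤ |ψ x| * |g x - Q.avg g| + |ψ x - ψ Q.center| * |Q.avg g| := by
          rw [← abs_mul, ← abs_mul]
          exact abs_add_le _ _
      _ ≤ 1 * |g x - Q.avg g| + L * Q.half * |Q.avg g| := by
          gcongr
          · exact hψ x
          · exact (hLip x Q.center).trans (by gcongr)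
      _ = |g x - Q.avg g| + L * Q.half * |Q.avg g| := by rw [one_mul]
  rw [integral_add hi (integrable_const _), ← osc_eq] at key
  simp at key
  have := osc_le_two_mul hgψ (ψ Q.center * Q.avg g)
  simp only [side]
  linarith

theorem toSet_subset_closedBall {Q : Cube n} {R t : ℝ} (hQ : Q.side ≤ t)
    (h : ¬ Disjoint Q.toSet (closedBall 0 R)) : Q.toSet ⊆ closedBall 0 (R + t) := by
  obtain ⟨y, hy, hyR⟩ := Set.not_disjoint_iff.1 h
  intro x hx
  simp only [toSet, side, mem_closedBall] at *
  linarith [dist_triangle x y 0, dist_triangle_right x y Q.center]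

theorem lt_distToOrigin {Q : Cube n} {R : ℝ} (h : Disjoint Q.toSet (closedBall 0 R)) :
    R < Q.distToOrigin := by
  have hne : Q.toSet.Nonempty := ⟨Q.center, mem_closedBall_self Q.half_pos.le⟩
  obtain ⟨y, hy, hyd⟩ := (isCompact_closedBall Q.center Q.half).exists_infDist_eq_dist hne 0
  have : y ∉ closedBall 0 R := Set.disjoint_left.1 h hy
  rw [mem_closedBall, not_le, dist_comm] at this
  unfold distToOrigin
  exact this.trans_eq hyd.symm

/-- The cells of the subdivision of a cube into `N ^ n` congruent cubes. -/
def cell (Q : Cube n) {N : ℕ} (hN : 0 < N) (i : Fin n → Fin N) : Cube n where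
  center k := Q.center k - Q.half + (2 * (i k : ℝ) + 1) * (Q.half / N)
  half := Q.half / N
  half_pos := div_pos Q.half_pos (by exact_mod_cast hN)

theorem mem_toSet_iff {Q : Cube n} {x : Fin n → ℝ} :
    x ∈ Q.toSet ↔ ∀ k, |x k - Q.center k| ≤ Q.half := by
  simp [toSet, dist_pi_le_iff Q.half_pos.le, Real.dist_eq]

theorem cell_subset (Q : Cube n) {N : ℕ} (hN : 0 < N) (i : Fin n → Fin N) :
    (Q.cell hN i).toSet ⊆ Q.toSet := by
  intro x hx
  rw [mem_toSet_iff] at *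
  intro k
  have h := abs_le.1 (hx k)
  simp only [cell] at h
  have hN' : (0 : ℝ) < N := by exact_mod_cast hN
  have hd : 0 < Q.half / N := div_pos Q.half_pos hN'
  have hmul : Q.half / N * N = Q.half := div_mul_cancel₀ _ hN'.ne'
  have h0 : 0 ≤ (i k : ℝ) * (Q.half / N) := by positivity
  have h1 : ((i k : ℝ) + 1) * (Q.half / N) ≤ N * (Q.half / N) := by
    gcongr
    exact_mod_cast (i k).2
  rw [abs_le]
  constructor <;> nlinarith

theorem toSet_subset_iUnion_cell (Q : Cube n) {N : ℕ} (hN : 0 < N) :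
    Q.toSet ⊆ ⋃ i, (Q.cell hN i).toSet := by
  intro x hx
  rw [mem_toSet_iff] at hx
  have hN' : (0 : ℝ) < N := by exact_mod_cast hN
  set d := Q.half / N with hd_def
  have hd : 0 < d := div_pos Q.half_pos hN'
  have hmul : d * N = Q.half := div_mul_cancel₀ _ hN'.ne'
  have hi : ∀ k, ∃ j : Fin N, |x k - (Q.center k - Q.half + (2 * (j : ℝ) + 1) * d)| ≤ d := by
    intro k
    have h := abs_le.1 (hx k)
    set t := (x k - Q.center k + Q.half) / (2 * d) with ht_def
    have ht : t * (2 * d) = x k - Q.center k + Q.half := div_mul_cancel₀ _ (by positivity)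
    have ht0 : 0 ≤ t := div_nonneg (by linarith) (by positivity)
    have htN : t ≤ N := by
      rw [ht_def, div_le_iff₀ (by positivity)]
      nlinarith
    by_cases hlt : t < N
    · refine ⟨⟨⌊t⌋₊, (Nat.floor_lt ht0).2 hlt⟩, ?_⟩
      have h1 := Nat.floor_le ht0
      have h2 := Nat.lt_floor_add_one t
      rw [abs_le]
      constructor <;> simp only <;> nlinarith
    · refine ⟨⟨N - 1, by omega⟩, ?_⟩
      have htN' : t = N := le_antisymm htN (not_lt.1 hlt)
      rw [htN'] at ht
      simp only [Nat.cast_sub (Nat.one_le_iff_ne_zero.2 hN.ne'), Nat.cast_one]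
      rw [abs_le]
      constructor <;> nlinarith
  choose i hi using hi
  exact Set.mem_iUnion.2 ⟨i, mem_toSet_iff.2 hi⟩

/-- A bound for the means over the cells of a subdivision carries over to the cube. -/
theorem avgAbs_le_of_cell {Q : Cube n} {N : ℕ} (hN : 0 < N) {g : (Fin n → ℝ) → ℝ} {ε : ℝ}
    (hg : IntegrableOn g Q.toSet) (H : ∀ i, (Q.cell hN i).avgAbs g ≤ ε) :
    Q.avgAbs g ≤ ε := by
  have hN' : (0 : ℝ) < N := by exact_mod_cast hN
  have hQ := Q.half_pos
  have hcell : ∀ i, ∫ x in (Q.cell hN i).toSet, |g x| ≤ (2 * (Q.half / N)) ^ n * ε := by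
    intro i
    rw [setIntegral_abs_eq]
    exact mul_le_mul_of_nonneg_left (H i) (by simp only [cell]; positivity)
  have hQU : Q.toSet = ⋃ i, (Q.cell hN i).toSet :=
    (Q.toSet_subset_iUnion_cell hN).antisymm (Set.iUnion_subset (Q.cell_subset hN))
  have hsum : ∫ x in Q.toSet, |g x| ≤ ∑ i, ∫ x in (Q.cell hN i).toSet, |g x| := by
    have hint : ∀ i, IntegrableOn (fun x => |g x|) (Q.cell hN i).toSet := fun i =>
      (hg.mono_set (Q.cell_subset hN i)).abs
    rw [← integral_finsetSum_measure fun i _ => hint i]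
    refine integral_mono_measure ?_ (ae_of_all _ fun _ => abs_nonneg _)
      (integrable_finsetSum_measure.2 fun i _ => hint i)
    rw [hQU, ← Measure.sum_fintype]
    exact Measure.restrict_iUnion_le
  have hcard : ∑ i : Fin n → Fin N, ∫ x in (Q.cell hN i).toSet, |g x| ≤
      (2 * Q.half) ^ n * ε := by
    refine (Finset.sum_le_sum fun i _ => hcell i).trans_eq ?_
    simp only [Finset.sum_const, Finset.card_univ, Fintype.card_fun, Fintype.card_fin,
      nsmul_eq_mul, Nat.cast_pow]
    rw [← mul_assoc, ← mul_pow]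
    congr 2
    field_simp
  rw [setIntegral_abs_eq] at hsum
  exact le_of_mul_le_mul_left (hsum.trans hcard) (by positivity)

/-- Every cube of sidelength at least `t` has a subdivision into cubes of sidelength in
`[t, 2 * t]`. -/
theorem exists_cell_side {Q : Cube n} {t : ℝ} (ht : 0 < t) (hQ : t ≤ Q.side) :
    ∃ (N : ℕ) (hN : 0 < N), ∀ i, t ≤ (Q.cell hN i).side ∧ (Q.cell hN i).side ≤ 2 * t := by
  have h1 : 1 ≤ Q.side / t := (one_le_div ht).2 hQ
  have hN : 0 < ⌊Q.side / t⌋₊ := Nat.floor_pos.2 h1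
  set N := ⌊Q.side / t⌋₊
  refine ⟨N, hN, fun i => ?_⟩
  have hN' : (1 : ℝ) ≤ N := by exact_mod_cast hN
  have hle : N * t ≤ Q.side := (le_div_iff₀ ht).1 (Nat.floor_le (by linarith))
  have hlt : Q.side < (N + 1) * t := (div_lt_iff₀ ht).1 (Nat.lt_floor_add_one _)
  have hs : (Q.cell hN i).side = Q.side / N := by
    simp only [side, cell]
    ring
  rw [hs, le_div_iff₀ (by linarith), div_le_iff₀ (by linarith)]
  constructor <;> nlinarith

end Cube

/-- A radial cutoff which vanishes on the ball of radius `r`, equals `1` outside the ball of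
radius `r + δ⁻¹` and is `δ`-Lipschitz. -/
def radialCutoff (r δ : ℝ) (x : Fin n → ℝ) : ℝ := min 1 (max 0 (δ * (‖x‖ - r)))

theorem radialCutoff_nonneg (r δ : ℝ) (x : Fin n → ℝ) : 0 ≤ radialCutoff r δ x :=
  le_min zero_le_one (le_max_left _ _)

theorem radialCutoff_le_one (r δ : ℝ) (x : Fin n → ℝ) : radialCutoff r δ x ≤ 1 :=
  min_le_left _ _

theorem abs_radialCutoff_le_one (r δ : ℝ) (x : Fin n → ℝ) : |radialCutoff r δ x| ≤ 1 := by
  rw [abs_of_nonneg (radialCutoff_nonneg r δ x)]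
  exact radialCutoff_le_one r δ x

theorem radialCutoff_eq_zero {r δ : ℝ} (hδ : 0 ≤ δ) {x : Fin n → ℝ} (hx : x ∈ closedBall 0 r) :
    radialCutoff r δ x = 0 := by
  rw [mem_closedBall_zero_iff] at hx
  rw [radialCutoff, max_eq_left (mul_nonpos_of_nonneg_of_nonpos hδ (by linarith)),
    min_eq_right zero_le_one]

theorem radialCutoff_eq_one {r δ : ℝ} (hδ : 0 < δ) {x : Fin n → ℝ} (hx : r + δ⁻¹ ≤ ‖x‖) :
    radialCutoff r δ x = 1 := by
  have h : 1 ≤ δ * (‖x‖ - r) := by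
    rw [← mul_inv_cancel₀ hδ.ne']
    gcongr
    linarith
  rw [radialCutoff, min_eq_left (h.trans (le_max_right _ _))]

theorem continuous_radialCutoff (r δ : ℝ) : Continuous (radialCutoff r δ : (Fin n → ℝ) → ℝ) := by
  unfold radialCutoff
  fun_prop

theorem abs_radialCutoff_sub_le {r δ : ℝ} (hδ : 0 ≤ δ) (x y : Fin n → ℝ) :
    |radialCutoff r δ x - radialCutoff r δ y| ≤ δ * dist x y := by
  calc |radialCutoff r δ x - radialCutoff r δ y|
      ≤ |max 0 (δ * (‖x‖ - r)) - max 0 (δ * (‖y‖ - r))| := by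
        simpa [radialCutoff] using abs_min_sub_min_le_max 1 (max 0 (δ * (‖x‖ - r))) 1 (max 0 (δ * (‖y‖ - r)))
    _ ≤ |δ * (‖x‖ - r) - δ * (‖y‖ - r)| := by
        simpa using abs_max_sub_max_le_max 0 (δ * (‖x‖ - r)) 0 (δ * (‖y‖ - r))
    _ = δ * |‖x‖ - ‖y‖| := by
        rw [← mul_sub, sub_sub_sub_cancel_right, abs_mul, abs_of_nonneg hδ]
    _ ≤ δ * dist x y := by
        gcongr
        rw [dist_eq_norm]
        exact abs_norm_sub_norm_le x y

theorem integrableOn_mul_of_continuous {Q : Cube n} {g ψ : (Fin n → ℝ) → ℝ}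
    (hg : IntegrableOn g Q.toSet) (hc : Continuous ψ) (hψ : ∀ x, |ψ x| ≤ 1) :
    IntegrableOn (fun x => ψ x * g x) Q.toSet :=
  hg.bdd_mul hc.aestronglyMeasurable (ae_of_all _ hψ)

theorem omegaOn_nonneg (U : Set (Fin n → ℝ)) (g : (Fin n → ℝ) → ℝ) (t : ℝ) :
    0 ≤ omegaOn U g t :=
  Real.sSup_nonneg (by rintro r ⟨Q, -, -, rfl⟩; exact Q.osc_nonneg g)

theorem bigAvgSup_nonneg (U : Set (Fin n → ℝ)) (lam : ℝ) (g : (Fin n → ℝ) → ℝ) :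
    0 ≤ bigAvgSup U lam g :=
  Real.sSup_nonneg (by rintro r ⟨Q, -, -, rfl⟩; exact Q.avgAbs_nonneg g)

theorem bmoNorm_nonneg (U : Set (Fin n → ℝ)) (lam : ℝ) (g : (Fin n → ℝ) → ℝ) :
    0 ≤ bmoNorm U lam g :=
  add_nonneg (omegaOn_nonneg U g lam) (bigAvgSup_nonneg U lam g)

namespace MemBmo

theorem mono {U V : Set (Fin n → ℝ)} {lam : ℝ} {g : (Fin n → ℝ) → ℝ} (hg : MemBmo U lam g)
    (hV : V ⊆ U) : MemBmo V lam g := by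
  refine ⟨fun Q hQ => hg.1 Q (hQ.trans hV), hg.2.1.mono ?_, hg.2.2.mono ?_⟩ <;>
  · rintro r ⟨Q, hQ, h⟩
    exact ⟨Q, hQ.trans hV, h⟩

theorem osc_le {U : Set (Fin n → ℝ)} {lam : ℝ} {g : (Fin n → ℝ) → ℝ} (hg : MemBmo U lam g)
    {Q : Cube n} (hQ : Q.toSet ⊆ U) (h : Q.side < lam) : Q.osc g ≤ bmoNorm U lam g :=
  (le_csSup hg.2.1 ⟨Q, hQ, h, rfl⟩).trans (le_add_of_nonneg_right (bigAvgSup_nonneg U lam g))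

theorem avgAbs_le {U : Set (Fin n → ℝ)} {lam : ℝ} {g : (Fin n → ℝ) → ℝ} (hg : MemBmo U lam g)
    {Q : Cube n} (hQ : Q.toSet ⊆ U) (h : lam ≤ Q.side) : Q.avgAbs g ≤ bmoNorm U lam g :=
  (le_csSup hg.2.2 ⟨Q, hQ, h, rfl⟩).trans (le_add_of_nonneg_left (omegaOn_nonneg U g lam))

section Cutoff

variable {Ω : Set (Fin n → ℝ)} {lam R δ : ℝ} {f : (Fin n → ℝ) → ℝ} {Q : Cube n}

theorem integrableOn_radialCutoff_mul (hf : MemBmo Ω lam f) (hQ : Q.toSet ⊆ Ω) (r δ : ℝ) :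
    IntegrableOn (fun x => radialCutoff r δ x * f x) Q.toSet :=
  integrableOn_mul_of_continuous (hf.1 Q hQ) (continuous_radialCutoff r δ)
    (abs_radialCutoff_le_one r δ)

theorem osc_radialCutoff_mul_le {β M : ℝ} (hf : MemBmo Ω lam f)
    (hM : ∀ Q : Cube n, Q.toSet ⊆ Ω → β < Q.distToOrigin → Q.side < lam →
      |Q.avg f| * Q.side ≤ M)
    (hM0 : 0 ≤ M) (hR : β ≤ R) (hδ : 0 ≤ δ) (hQ : Q.toSet ⊆ Ω) (hside : Q.side < lam) :
    Q.osc (fun x => radialCutoff (R + 2 * lam) δ x * f x) ≤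
      2 * bmoNorm (Ω \ closedBall 0 R) lam f + δ * M := by
  by_cases hdisj : Disjoint Q.toSet (closedBall 0 R)
  · have h1 := (hf.mono Set.sdiff_subset).osc_le (Set.subset_sdiff.2 ⟨hQ, hdisj⟩) hside
    have h2 := hM Q hQ (hR.trans_lt (Cube.lt_distToOrigin hdisj)) hside
    refine (Cube.osc_mul_le (hf.1 Q hQ) (hf.integrableOn_radialCutoff_mul hQ _ δ) hδ
      (abs_radialCutoff_le_one _ δ) (abs_radialCutoff_sub_le hδ)).trans ?_
    gcongr
  · have hpos := Q.half_pos
    have hsub := Cube.toSet_subset_closedBall (t := 2 * lam)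
      (by simp only [Cube.side] at *; linarith) hdisj
    have hzero : Set.EqOn (fun x => radialCutoff (R + 2 * lam) δ x * f x) (fun _ => 0)
        Q.toSet := fun x hx => by simp [radialCutoff_eq_zero hδ (hsub hx)]
    have hosc : Q.osc (fun _ => 0) = 0 := by simp [Cube.osc_eq, Cube.avg_eq]
    rw [Cube.osc_congr hzero, hosc]
    have := bmoNorm_nonneg (Ω \ closedBall 0 R) lam f
    positivity

theorem avgAbs_radialCutoff_mul_le (hf : MemBmo Ω lam f) (hlam : 0 < lam) (hδ : 0 ≤ δ)
    (hQ : Q.toSet ⊆ Ω) (hside : lam ≤ Q.side) :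
    Q.avgAbs (fun x => radialCutoff (R + 2 * lam) δ x * f x) ≤
      bmoNorm (Ω \ closedBall 0 R) lam f := by
  obtain ⟨N, hN, hcell⟩ := Cube.exists_cell_side hlam hside
  refine Cube.avgAbs_le_of_cell hN (hf.integrableOn_radialCutoff_mul hQ _ δ) fun i => ?_
  have hsubΩ := (Q.cell_subset hN i).trans hQ
  by_cases hdisj : Disjoint (Q.cell hN i).toSet (closedBall 0 R)
  · refine (Cube.avgAbs_mono (hf.1 _ hsubΩ) fun x _ => ?_).trans
      ((hf.mono Set.sdiff_subset).avgAbs_le (Set.subset_sdiff.2 ⟨hsubΩ, hdisj⟩) (hcell i).1)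
    rw [abs_mul]
    exact mul_le_of_le_one_left (abs_nonneg _) (abs_radialCutoff_le_one _ δ x)
  · have hsub := Cube.toSet_subset_closedBall (hcell i).2 hdisj
    have hzero : Set.EqOn (fun x => radialCutoff (R + 2 * lam) δ x * f x) (fun _ => 0)
        (Q.cell hN i).toSet := fun x hx => by simp [radialCutoff_eq_zero hδ (hsub hx)]
    have havg : (Q.cell hN i).avgAbs (fun _ => 0) = 0 := by simp [Cube.avgAbs_eq]
    rw [Cube.avgAbs_congr hzero, havg]
    exact bmoNorm_nonneg _ _ _

end Cutoff

end MemBmo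

/-- Lemma (vanishing at infinity on a domain): if f ∈ bmo_λ(Ω) vanishes at infinity and
sup{|f_Q|·ℓ(Q)} over small cubes far from the origin is finite, then f is in the
bmo_λ(Ω)-closure of the functions with compact (i.e. bounded) support in the closure of Ω. -/
theorem stmt10 {n : ℕ} (hn : 0 < n) (Ω : Set (Fin n → ℝ)) (hΩ : IsRealDomain Ω)
    (lam : ℝ) (hlam : 0 < lam) (f : (Fin n → ℝ) → ℝ)
    (hf : MemBmo Ω lam f)
    (hvan : VanishAtInfinity Ω lam f)
    (hbd : ∃ β : ℝ, 0 < β ∧ BddAbove {r | ∃ Q : Cube n,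
      Q.toSet ⊆ Ω ∧ β < Q.distToOrigin ∧ Q.side < lam ∧ r = |Q.avg f| * Q.side}) :
    ∃ F : ℕ → (Fin n → ℝ) → ℝ,
      (∀ k, MemBmo Ω lam (F k) ∧ IsCompact (tsupport (F k)) ∧ tsupport (F k) ⊆ closure Ω) ∧
      Tendsto (fun k => bmoNorm Ω lam (f - F k)) atTop (nhds 0) := by
  obtain ⟨β, -, M, hM⟩ := hbd
  have hM' : ∀ Q : Cube n, Q.toSet ⊆ Ω → β < Q.distToOrigin → Q.side < lam →
      |Q.avg f| * Q.side ≤ max M 0 := fun Q h1 h2 h3 =>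
    (hM ⟨Q, h1, h2, h3, rfl⟩).trans (le_max_left _ _)
  set R : ℕ → ℝ := fun k => β + k
  set δ : ℕ → ℝ := fun k => 1 / ((k : ℝ) + 1)
  have hδ : ∀ k, 0 < δ k := fun k => Nat.one_div_pos_of_nat
  have hR : ∀ k, β ≤ R k := fun k => le_add_of_nonneg_right k.cast_nonneg
  set ψ : ℕ → (Fin n → ℝ) → ℝ := fun k => radialCutoff (R k + 2 * lam) (δ k)
  set B : ℕ → ℝ := fun k => bmoNorm (Ω \ closedBall 0 (R k)) lam f
  have hB : ∀ k, 0 ≤ B k := fun k => bmoNorm_nonneg _ _ _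
  have hosc : ∀ k, ∀ Q : Cube n, Q.toSet ⊆ Ω → Q.side < lam →
      Q.osc (fun x => ψ k x * f x) ≤ 2 * B k + δ k * max M 0 := fun k Q hQ hs =>
    hf.osc_radialCutoff_mul_le hM' (le_max_right _ _) (hR k) (hδ k).le hQ hs
  have hF : ∀ k, Set.EqOn (Ω.indicator fun x => (1 - ψ k x) * f x)
      (f - fun x => ψ k x * f x) Ω := fun k x hx => by
    simp only [Set.indicator_of_mem hx, Pi.sub_apply]
    ring
  have hsub : ∀ k, Set.EqOn (f - Ω.indicator fun x => (1 - ψ k x) * f x)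
      (fun x => ψ k x * f x) Ω := fun k x hx => by
    simp only [Pi.sub_apply, Set.indicator_of_mem hx]
    ring
  refine ⟨fun k => Ω.indicator fun x => (1 - ψ k x) * f x, fun k => ⟨⟨?_, ?_, ?_⟩, ?_, ?_⟩, ?_⟩
  · intro Q hQ
    exact ((hf.1 Q hQ).sub (hf.integrableOn_radialCutoff_mul hQ _ _)).congr_fun
      ((hF k).mono hQ).symm Q.measurableSet_toSet
  · refine ⟨bmoNorm Ω lam f + (2 * B k + δ k * max M 0), ?_⟩
    rintro r ⟨Q, hQ, hs, rfl⟩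
    rw [Cube.osc_congr ((hF k).mono hQ)]
    exact (Cube.osc_sub_le (hf.1 Q hQ) (hf.integrableOn_radialCutoff_mul hQ _ _)).trans
      (add_le_add (hf.osc_le hQ hs) (hosc k Q hQ hs))
  · refine ⟨bmoNorm Ω lam f, ?_⟩
    rintro r ⟨Q, hQ, hs, rfl⟩
    refine (Cube.avgAbs_mono (hf.1 Q hQ) fun x hx => ?_).trans (hf.avgAbs_le hQ hs)
    have h0 := radialCutoff_nonneg (R k + 2 * lam) (δ k) x
    have h1 := radialCutoff_le_one (R k + 2 * lam) (δ k) x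
    beta_reduce
    rw [Set.indicator_of_mem (hQ hx), abs_mul]
    exact mul_le_of_le_one_left (abs_nonneg _)
      (abs_le.2 ⟨by simp only [ψ]; linarith, by simp only [ψ]; linarith⟩)
  · refine HasCompactSupport.of_support_subset_isCompact
      (isCompact_closedBall (0 : Fin n → ℝ) (R k + 2 * lam + (δ k)⁻¹)) fun x hx => ?_
    rw [mem_closedBall_zero_iff]
    by_contra! hlt
    refine hx ?_
    have : ψ k x = 1 := radialCutoff_eq_one (hδ k) hlt.le
    simp [this]
  · exact closure_mono Set.support_indicator_subset
  · have hRtop : Tendsto R atTop atTop :=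
      tendsto_atTop_add_const_left _ β tendsto_natCast_atTop_atTop
    have hBlim : Tendsto B atTop (𝓝 0) := hvan.comp hRtop
    have hlim : Tendsto (fun k => (2 * B k + δ k * max M 0) + B k) atTop (𝓝 0) := by
      simpa [δ] using ((hBlim.const_mul 2).add
        (tendsto_one_div_add_atTop_nhds_zero_nat.mul_const (max M 0))).add hBlim
    refine squeeze_zero (fun k => bmoNorm_nonneg _ _ _) (fun k => add_le_add ?_ ?_) hlim
    · refine Real.sSup_le ?_ (by have := hB k; have := hδ k; positivity)
      rintro r ⟨Q, hQ, hs, rfl⟩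
      rw [Cube.osc_congr ((hsub k).mono hQ)]
      exact hosc k Q hQ hs
    · refine Real.sSup_le ?_ (hB k)
      rintro r ⟨Q, hQ, hs, rfl⟩
      rw [Cube.avgAbs_congr ((hsub k).mono hQ)]
      exact hf.avgAbs_radialCutoff_mul_le hlam (hδ k).le hQ hs
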